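/- Fix 1 < p < 2. There exists β₀ = β₀(p) such that for every β ≥ β₀ there is a constant c = c(β,p) > 0 with the following property: for every integer h ≥ 2 there exists L₀ = L₀(β,h) such that for all integers L ≥ L₀, π^{(p)}_{B_L}(η_0 = h) ≤ e^{−c·β·h^{p−1}} · π^{(p)}_{B_L}(η_0 = h−1). -/

import Mathlib

open Filter Topology Classical

noncomputable section

abbrev Site : Type := ℤ × ℤ

/-- Nearest-neighbor adjacency in `ℤ²`. -/
def adjP (x y : Site) : Prop := |x.1 - y.1| + |x.2 - y.2| = 1

/-- The `p`-SOS Hamiltonian `∑_{x∼y} |η_x − η_y|^p` (each ordered pair counted once,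
whence the factor 1/2). -/
def pH (p : ℝ) (η : Site → ℤ) : ℝ :=
  (1 / 2) * ∑' pr : Site × Site,
    if adjP pr.1 pr.2 then ((|η pr.1 - η pr.2| : ℤ) : ℝ) ^ p else 0

/-- Unnormalized weight of the event `A` for the `p`-SOS model on `Λ` with zero
boundary conditions. -/
def pW (p β : ℝ) (Λ : Finset Site) (A : (Site → ℤ) → Prop) : ℝ :=
  ∑' η : Site → ℤ, if (∀ x ∉ Λ, η x = 0) ∧ A η then Real.exp (-β * pH p η) else 0

/-- `π^{(p)}_Λ(A)`: probability of the event `A` under the `p`-SOS measure on `Λ`. -/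
def pProb (p β : ℝ) (Λ : Finset Site) (A : (Site → ℤ) → Prop) : ℝ :=
  pW p β Λ A / pW p β Λ (fun _ => True)

/-- The lattice ball `B_r = {x ∈ ℤ² : |x| ≤ r}`. -/
def ball (r : ℝ) : Finset Site :=
  ((Finset.Icc (-⌈r⌉) ⌈r⌉) ×ˢ (Finset.Icc (-⌈r⌉) ⌈r⌉)).filter
    fun x => ((x.1 : ℝ) ^ 2 + (x.2 : ℝ) ^ 2 ≤ r ^ 2)


abbrev Edge : Type := Site × Bool

def tip (e : Edge) : Site := if e.2 then (e.1.1, e.1.2 + 1) else (e.1.1 + 1, e.1.2)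

def dd (φ : Site → ℤ) (e : Edge) : ℤ := φ (tip e) - φ e.1

def eadj (e f : Edge) : Prop := |e.1.1 - f.1.1| ≤ 1 ∧ |e.1.2 - f.1.2| ≤ 1

def VV (p : ℝ) (m : ℤ) : ℝ := ((|m| : ℤ) : ℝ) ^ p

def HE (p : ℝ) (φ : Site → ℤ) : ℝ := ∑' e : Edge, VV p (dd φ e)

lemma VV_zero {p : ℝ} (hp : 1 < p) : VV p 0 = 0 := by
  simp [VV, Real.zero_rpow (by linarith : p ≠ 0)]

lemma VV_nonneg (p : ℝ) (m : ℤ) : 0 ≤ VV p m := by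
  unfold VV; positivity

lemma VV_neg (p : ℝ) (m : ℤ) : VV p (-m) = VV p m := by
  simp [VV]

lemma VV_ge {p : ℝ} (hp : 1 < p) (m : ℤ) : ((|m| : ℤ) : ℝ) ≤ VV p m := by
  rcases eq_or_ne m 0 with rfl | hm
  · simp [VV_nonneg]
  · have h1 : (1 : ℝ) ≤ ((|m| : ℤ) : ℝ) := by
      exact_mod_cast Int.one_le_abs hm
    unfold VV
    calc ((|m| : ℤ) : ℝ) = ((|m| : ℤ) : ℝ) ^ (1 : ℝ) := by rw [Real.rpow_one]
      _ ≤ _ := Real.rpow_le_rpow_of_exponent_le h1 hp.le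

def pairOf (q : Edge × Bool) : Site × Site := if q.2 then (q.1.1, tip q.1) else (tip q.1, q.1.1)

lemma pairOf_inj : Function.Injective pairOf := by
  rintro ⟨⟨⟨a, b⟩, c⟩, d⟩ ⟨⟨⟨a', b'⟩, c'⟩, d'⟩ h
  cases c <;> cases d <;> cases c' <;> cases d' <;> simp [pairOf, tip] at h <;>
    simp <;> omega

lemma adj_pairOf (q : Edge × Bool) : adjP (pairOf q).1 (pairOf q).2 := by
  obtain ⟨⟨⟨a, b⟩, c⟩, d⟩ := q
  cases c <;> cases d <;> simp [pairOf, tip, adjP]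

lemma pairOf_surj (x y : Site) (h : adjP x y) : ∃ q, pairOf q = (x, y) := by
  obtain ⟨a, b⟩ := x
  obtain ⟨c, d⟩ := y
  simp only [adjP] at h
  have : (c = a + 1 ∧ d = b) ∨ (a = c + 1 ∧ d = b) ∨ (c = a ∧ d = b + 1) ∨ (c = a ∧ b = d + 1) := by
    rcases abs_cases (a - c) with h1 | h1 <;> rcases abs_cases (b - d) with h2 | h2 <;> omega
  rcases this with ⟨rfl, rfl⟩ | ⟨rfl, rfl⟩ | ⟨rfl, rfl⟩ | ⟨rfl, rfl⟩
  · exact ⟨(((a, d), false), true), by simp [pairOf, tip]⟩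
  · exact ⟨(((c, d), false), false), by simp [pairOf, tip]⟩
  · exact ⟨(((c, b), true), true), by simp [pairOf, tip]⟩
  · exact ⟨(((c, d), true), false), by simp [pairOf, tip]⟩

lemma dd_fin {φ : Site → ℤ} (Λ : Finset Site) (h : ∀ x ∉ Λ, φ x = 0) :
    ∃ E : Finset Edge, ∀ e, e ∈ E ↔ dd φ e ≠ 0 := by
  have : Set.Finite {e : Edge | dd φ e ≠ 0} := by
    apply Set.Finite.subset
      (s := ((Λ ∪ Λ.image (fun x => (x.1 - 1, x.2)) ∪ Λ.image (fun x => (x.1, x.2 - 1))) ×ˢ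
        (Finset.univ : Finset Bool) : Finset Edge)) (Finset.finite_toSet _)
    rintro ⟨⟨a, b⟩, c⟩ he
    by_contra hc
    apply he
    simp only [Finset.coe_product, Finset.coe_univ, Set.mem_prod, Finset.mem_coe, Finset.mem_union,
      Finset.mem_image, Set.mem_univ, and_true, not_or, not_exists, not_and] at hc
    obtain ⟨⟨h1, h2⟩, h3⟩ := hc
    have h0 := h _ h1
    cases c
    · have := h (a + 1, b) (fun hh => h2 _ hh (by simp))
      simp [dd, tip, h0, this]
    · have := h (a, b + 1) (fun hh => h3 _ hh (by simp))
      simp [dd, tip, h0, this]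
  exact ⟨this.toFinset, by simp⟩

lemma HE_eq_sum {p : ℝ} (hp : 1 < p) {φ : Site → ℤ} {E : Finset Edge}
    (hE : ∀ e, dd φ e ≠ 0 → e ∈ E) : HE p φ = ∑ e ∈ E, VV p (dd φ e) := by
  apply tsum_eq_sum
  intro e he
  have : dd φ e = 0 := by by_contra h; exact he (hE e h)
  rw [this, VV_zero hp]

lemma HE_summable {p : ℝ} (hp : 1 < p) {φ : Site → ℤ} {E : Finset Edge}
    (hE : ∀ e, dd φ e ≠ 0 → e ∈ E) : Summable (fun e : Edge => VV p (dd φ e)) := by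
  apply summable_of_ne_finset_zero (s := E)
  intro e he
  have : dd φ e = 0 := by by_contra h; exact he (hE e h)
  rw [this, VV_zero hp]

lemma pH_eq {p : ℝ} (hp : 1 < p) {φ : Site → ℤ} {E : Finset Edge}
    (hE : ∀ e, dd φ e ≠ 0 → e ∈ E) : pH p φ = HE p φ := by
  unfold pH
  rw [← pairOf_inj.tsum_eq]
  · have h1 : ∀ q : Edge × Bool, (if adjP (pairOf q).1 (pairOf q).2 then
        ((|φ (pairOf q).1 - φ (pairOf q).2| : ℤ) : ℝ) ^ p else 0) = VV p (dd φ q.1) := by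
      intro q
      rw [if_pos (adj_pairOf q)]
      unfold VV dd pairOf
      split_ifs
      · rw [abs_sub_comm]
      · rfl
    simp_rw [h1]
    rw [tsum_eq_sum (s := E ×ˢ (Finset.univ : Finset Bool))]
    · rw [Finset.sum_product, HE_eq_sum hp hE]
      simp only [Finset.sum_const, Finset.card_univ, Fintype.card_bool, ← Finset.smul_sum]
      simp
    · intro q hq
      have : dd φ q.1 = 0 := by
        by_contra h
        exact hq (by simp [hE _ h])
      rw [this, VV_zero hp]
  · rintro ⟨x, y⟩ hxy
    have : adjP x y := by
      by_contra h
      simp [h] at hxy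
    exact pairOf_surj x y this

lemma HE_nonneg (p : ℝ) (φ : Site → ℤ) : 0 ≤ HE p φ := tsum_nonneg fun _ => VV_nonneg _ _

/-- constancy along rays -/
lemma ray_right (g : ℤ → ℤ) (a : ℤ) (h : ∀ x, a ≤ x → g (x + 1) = g x)
    (hN : ∃ N : ℤ, ∀ x, N ≤ x → g x = 0) : g a = 0 := by
  obtain ⟨N, hN⟩ := hN
  have : ∀ x, a ≤ x → g x = g a := by
    intro x hx
    induction x, hx using Int.leInduction with
    | base => rfl
    | succ n hn ih => rw [h n hn, ih]
  rw [← this (max a N) (le_max_left _ _), hN _ (le_max_right _ _)]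

lemma ray_left (g : ℤ → ℤ) (a : ℤ) (h : ∀ x, x < a → g (x + 1) = g x)
    (hN : ∃ N : ℤ, ∀ x, x ≤ N → g x = 0) : g a = 0 := by
  have := ray_right (fun x => g (-x)) (-a) (by
    intro x hx
    have := h (-(x + 1)) (by omega)
    simp only [← this]
    congr 1; ring) (by
    obtain ⟨N, hN⟩ := hN
    exact ⟨-N, fun x hx => hN _ (by omega)⟩)
  simpa using this

def chiS (φ : Site → ℤ) (S : Finset Edge) (x : Site) : ℤ :=
  -∑ e ∈ S, if (e.2 = false ∧ e.1.2 = x.2 ∧ x.1 ≤ e.1.1) then dd φ e else 0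

def closedIn (φ : Site → ℤ) (S : Finset Edge) : Prop :=
  (∀ e ∈ S, dd φ e ≠ 0) ∧ ∀ e ∈ S, ∀ f, dd φ f ≠ 0 → eadj e f → f ∈ S

lemma edge_bound (S : Finset Edge) : ∃ N : ℤ, ∀ e ∈ S, |e.1.1| < N ∧ |e.1.2| < N := by
  refine ⟨∑ e ∈ S, (|e.1.1| + |e.1.2|) + 1, fun e he => ?_⟩
  have := Finset.single_le_sum (f := fun e : Edge => |e.1.1| + |e.1.2|)
    (fun i _ => by positivity) he
  try simp only at this
  have h1 := abs_nonneg e.1.1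
  have h2 := abs_nonneg e.1.2
  constructor <;> linarith

lemma chi_h (φ : Site → ℤ) (S : Finset Edge) (x y : ℤ) :
    dd (chiS φ S) ((x, y), false) = if ((x, y), false) ∈ S then dd φ ((x, y), false) else 0 := by
  have : dd (chiS φ S) ((x, y), false) = ∑ e ∈ S, if ((x, y), false) = e then dd φ e else 0 := by
    simp only [dd, tip, chiS]
    simp only [Bool.false_eq_true, if_false]
    rw [neg_sub_neg, ← Finset.sum_sub_distrib]
    apply Finset.sum_congr rfl
    rintro ⟨⟨a, b⟩, c⟩ _
    cases c
    · simp only [true_and, Prod.mk.injEq, and_true]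
      by_cases hb : b = y
      · subst hb
        by_cases h1 : a = x
        · subst h1; simp
        · have h1' : x ≠ a := fun h => h1 h.symm
          by_cases h2 : x ≤ a
          · have : x + 1 ≤ a := by omega
            simp [h2, this, h1']
          · have : ¬ (x + 1 ≤ a) := by omega
            simp [h2, this, h1']
      · have hb' : y ≠ b := fun h => hb h.symm
        simp [hb, hb']
    · simp
  rw [this, Finset.sum_ite_eq]

lemma chi_zero_right (φ : Site → ℤ) (S : Finset Edge) (N : ℤ) (hN : ∀ e ∈ S, |e.1.1| < N ∧ |e.1.2| < N)
    (x : Site) (hx : N ≤ x.1) : chiS φ S x = 0 := by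
  simp only [chiS, neg_eq_zero]
  apply Finset.sum_eq_zero
  intro e he
  rw [if_neg]
  rintro ⟨_, _, h⟩
  have := (abs_lt.mp (hN e he).1).2
  omega

lemma chi_zero_row (φ : Site → ℤ) (S : Finset Edge) (N : ℤ) (hN : ∀ e ∈ S, |e.1.1| < N ∧ |e.1.2| < N)
    (x : Site) (hx : N ≤ |x.2|) : chiS φ S x = 0 := by
  simp only [chiS, neg_eq_zero]
  apply Finset.sum_eq_zero
  intro e he
  rw [if_neg]
  rintro ⟨_, h, _⟩
  have := (hN e he).2
  rw [h] at this
  omega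

lemma dd_h (φ : Site → ℤ) (x y : ℤ) : dd φ ((x, y), false) = φ (x + 1, y) - φ (x, y) := by
  simp [dd, tip]

lemma dd_v (φ : Site → ℤ) (x y : ℤ) : dd φ ((x, y), true) = φ (x, y + 1) - φ (x, y) := by
  simp [dd, tip]

lemma closed_plaq (φ : Site → ℤ) (S : Finset Edge) (hS : closedIn φ S) (e f : Edge)
    (hef : eadj e f) (he : e ∈ S) : (if f ∈ S then dd φ f else 0) = dd φ f := by
  split_ifs with h
  · rfl
  · by_contra h'
    exact h (hS.2 e he f (fun h0 => h' h0.symm) hef)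

lemma chi_v (φ : Site → ℤ) (S : Finset Edge) (hS : closedIn φ S) (x y : ℤ) :
    dd (chiS φ S) ((x, y), true) = if ((x, y), true) ∈ S then dd φ ((x, y), true) else 0 := by
  obtain ⟨N, hN⟩ := edge_bound S
  have key : ∀ x : ℤ, (if ((x, y), false) ∈ S then dd φ ((x, y), false) else 0)
      + (if ((x + 1, y), true) ∈ S then dd φ ((x + 1, y), true) else 0)
      = (if ((x, y), true) ∈ S then dd φ ((x, y), true) else 0)
      + (if ((x, y + 1), false) ∈ S then dd φ ((x, y + 1), false) else 0) := by
    intro x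
    have hd : dd φ ((x, y), false) + dd φ ((x + 1, y), true)
      = dd φ ((x, y), true) + dd φ ((x, y + 1), false) := by
      simp only [dd_h, dd_v]; ring
    by_cases h1 : (((x, y), false) : Edge) ∈ S
    · rw [closed_plaq φ S hS _ _ (by simp [eadj]) h1, closed_plaq φ S hS _ _ (by simp [eadj]) h1,
        closed_plaq φ S hS _ _ (by simp [eadj]) h1, closed_plaq φ S hS _ _ (by simp [eadj]) h1, hd]
    by_cases h2 : (((x + 1, y), true) : Edge) ∈ S
    · rw [closed_plaq φ S hS _ _ (by simp [eadj]) h2, closed_plaq φ S hS _ _ (by simp [eadj]) h2,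
        closed_plaq φ S hS _ _ (by simp [eadj]) h2, closed_plaq φ S hS _ _ (by simp [eadj]) h2, hd]
    by_cases h3 : (((x, y), true) : Edge) ∈ S
    · rw [closed_plaq φ S hS _ _ (by simp [eadj]) h3, closed_plaq φ S hS _ _ (by simp [eadj]) h3,
        closed_plaq φ S hS _ _ (by simp [eadj]) h3, closed_plaq φ S hS _ _ (by simp [eadj]) h3, hd]
    by_cases h4 : (((x, y + 1), false) : Edge) ∈ S
    · rw [closed_plaq φ S hS _ _ (by simp [eadj]) h4, closed_plaq φ S hS _ _ (by simp [eadj]) h4,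
        closed_plaq φ S hS _ _ (by simp [eadj]) h4, closed_plaq φ S hS _ _ (by simp [eadj]) h4, hd]
    simp [h1, h2, h3, h4]
  have := ray_right (fun x => dd (chiS φ S) ((x, y), true) -
    if ((x, y), true) ∈ S then dd φ ((x, y), true) else 0) x (by
      intro x _
      have h1 := key x
      rw [← chi_h, ← chi_h, dd_h, dd_h] at h1
      simp only [dd_v _ (x + 1) y, dd_v (chiS φ S) x y] at h1 ⊢
      linarith) ⟨N, by
      intro x hx
      simp only [dd_v (chiS φ S)]
      rw [chi_zero_right φ S N hN _ hx, chi_zero_right φ S N hN _ hx, if_neg]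
      · simp
      · intro h
        have := (abs_lt.mp (hN _ h).1).2
        simp at this
        omega⟩
  try simp only at this
  linarith

lemma chi_d (φ : Site → ℤ) (S : Finset Edge) (hS : closedIn φ S) (e : Edge) :
    dd (chiS φ S) e = if e ∈ S then dd φ e else 0 := by
  obtain ⟨⟨x, y⟩, b⟩ := e
  cases b
  · exact chi_h φ S x y
  · exact chi_v φ S hS x y

lemma chi_zero_left (φ : Site → ℤ) (S : Finset Edge) (hS : closedIn φ S) (N : ℤ)
    (hN : ∀ e ∈ S, |e.1.1| < N ∧ |e.1.2| < N)
    (x : Site) (hx : x.1 ≤ -N) : chiS φ S x = 0 := by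
  obtain ⟨x, y⟩ := x
  refine ray_right (fun y => chiS φ S (x, y)) y ?_ ⟨N, ?_⟩
  · intro y _
    have := chi_v φ S hS x y
    rw [if_neg, dd_v] at this
    · linarith
    · intro h
      have := (abs_lt.mp (hN _ h).1).1
      simp at this hx
      omega
  · intro y hy
    exact chi_zero_row φ S N hN _ (le_trans hy (le_abs_self _))

def rayLam (Λ : Finset Site) : Prop := ∀ x ∉ Λ,
  (∀ k : ℤ, x.1 ≤ k → (k, x.2) ∉ Λ) ∨ (∀ k : ℤ, k ≤ x.1 → (k, x.2) ∉ Λ)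

lemma chi_out {Λ : Finset Site} (hΛ : rayLam Λ) (φ : Site → ℤ) (hφ : ∀ x ∉ Λ, φ x = 0)
    (S : Finset Edge) (hS : closedIn φ S) (x : Site) (hx : x ∉ Λ) : chiS φ S x = 0 := by
  obtain ⟨N, hN⟩ := edge_bound S
  obtain ⟨x, y⟩ := x
  rcases hΛ _ hx with h | h
  · refine ray_right (fun x => chiS φ S (x, y)) x ?_ ⟨N, ?_⟩
    · intro k hk
      have := chi_h φ S k y
      rw [dd_h, dd_h, hφ _ (h k hk), hφ _ (h (k + 1) (by simp at hk ⊢; omega))] at this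
      simp at this
      linarith
    · intro k hk
      exact chi_zero_right φ S N hN _ hk
  · refine ray_left (fun x => chiS φ S (x, y)) x ?_ ⟨-N, ?_⟩
    · intro k hk
      have := chi_h φ S k y
      rw [dd_h, dd_h, hφ _ (h k (by simp; omega)), hφ _ (h (k + 1) (by simp; omega))] at this
      simp at this
      linarith
    · intro k hk
      exact chi_zero_left φ S hS N hN _ hk

lemma dd_unique {Λ : Finset Site} (φ : Site → ℤ) (hφ : ∀ x ∉ Λ, φ x = 0)
    (h : ∀ e, dd φ e = 0) : φ = 0 := by
  funext ⟨x, y⟩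
  refine ray_right (fun x => φ (x, y)) x ?_ ?_
  · intro k _
    have := h ((k, y), false)
    rw [dd_h] at this
    linarith
  · refine ⟨∑ e ∈ Λ, |e.1| + 1, fun k hk => hφ _ fun hm => ?_⟩
    have := Finset.single_le_sum (f := fun e : Site => |e.1|) (fun i _ => by positivity) hm
    have h2 := le_abs_self k
    try simp only at this
    omega

def axE (m : ℕ) : Edge := (((m : ℤ), 0), false)

/-- A closed set with nonzero winding touches the axis within distance its cardinality. -/
lemma axis_touch (φ : Site → ℤ) (K : Finset Edge) (hK : closedIn φ K)
    (h0 : chiS φ K (0, 0) ≠ 0) : ∃ m : ℕ, m < K.card ∧ axE m ∈ K := by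
  obtain ⟨N, hN⟩ := edge_bound K
  have hex : ∃ m : ℕ, axE m ∈ K := by
    by_contra hc
    push Not at hc
    apply h0
    refine ray_right (fun x => chiS φ K (x, 0)) 0 ?_ ⟨N, ?_⟩
    · intro x hx
      have := chi_h φ K x 0
      obtain ⟨n, rfl⟩ := Int.eq_ofNat_of_zero_le hx
      rw [if_neg (show ((((n : ℤ), 0), false) : Edge) ∉ K from hc n), dd_h] at this
      linarith
    · intro k hk
      exact chi_zero_right φ K N hN _ hk
  set m := Nat.find hex with hm
  refine ⟨m, ?_, Nat.find_spec hex⟩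
  have hconst : ∀ j : ℕ, j ≤ m → chiS φ K ((j : ℤ), 0) ≠ 0 := by
    intro j
    induction j with
    | zero => intro _; simpa using h0
    | succ j ih =>
      intro hj
      have h1 := ih (by omega)
      have := chi_h φ K j 0
      rw [if_neg (show ((((j : ℤ), 0), false) : Edge) ∉ K from Nat.find_min hex (by omega : j < _)), dd_h] at this
      push_cast
      intro h2
      apply h1
      linarith
  have hcol : ∀ j : ℕ, j ≤ m → ∃ y : ℤ, (((j : ℤ), y), true) ∈ K := by
    intro j hj
    by_contra hc
    push Not at hc
    apply hconst j hj
    refine ray_right (fun y => chiS φ K ((j : ℤ), y)) 0 ?_ ⟨N, ?_⟩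
    · intro y _
      have := chi_v φ K hK j y
      rw [if_neg (hc y), dd_v] at this
      linarith
    · intro y hy
      exact chi_zero_row φ K N hN _ (le_trans hy (le_abs_self _))
  choose! y hy using hcol
  have : (Finset.range (m + 1)).card ≤ K.card := by
    apply Finset.card_le_card_of_injOn (fun j : ℕ => (((j : ℤ), y j), true))
    · intro j hj
      simp only [Finset.coe_range, Set.mem_Iio] at hj
      exact hy j (by omega)
    · intro a _ b _ hab
      simpa using (congrArg (fun e : Edge => e.1.1) hab)
  simp at this
  omega

def rooted (T : Finset Edge) : Prop := axE 0 ∈ T ∧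
  ∀ A ⊆ T, axE 0 ∈ A → (∀ a ∈ A, ∀ b ∈ T, eadj a b → b ∈ A) → A = T

def goodT (χ : Site → ℤ) (T : Finset Edge) : Prop :=
  rooted T ∧ (∀ e, dd χ e ≠ 0 → e ∈ T) ∧ T.card ≤ 2 * (T.filter (fun e => dd χ e ≠ 0)).card

lemma eadj_symm {e f : Edge} (h : eadj e f) : eadj f e := by
  unfold eadj at *
  rwa [abs_sub_comm, abs_sub_comm f.1.2]

lemma decomp {Λ : Finset Site} (hΛ : rayLam Λ) (φ : Site → ℤ) (hφ : ∀ x ∉ Λ, φ x = 0)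
    (h0 : φ (0, 0) ≠ 0) : ∃ χ : Site → ℤ, (∀ x ∉ Λ, χ x = 0) ∧ χ (0, 0) = φ (0, 0) ∧
      (∀ e, dd χ e = 0 ∨ dd χ e = dd φ e) ∧ ∃ T, goodT χ T := by
  obtain ⟨E, hE⟩ := dd_fin Λ hφ
  have hEc : closedIn φ E := ⟨fun e he => (hE e).1 he, fun e _ f hf _ => (hE f).2 hf⟩
  have hEχ : chiS φ E (0, 0) = φ (0, 0) := by
    have := dd_unique (Λ := Λ) (fun x => chiS φ E x - φ x)
      (fun x hx => by simp [chi_out hΛ φ hφ E hEc x hx, hφ x hx]) (by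
        intro e
        have h1 := chi_d φ E hEc e
        have h2 : dd (fun x => chiS φ E x - φ x) e = dd (chiS φ E) e - dd φ e := by
          simp only [dd]; ring
        rw [h2, h1]
        split_ifs with h
        · simp
        · have : dd φ e = 0 := by
            by_contra h'
            exact h ((hE e).2 h')
          simp [this])
    have := congrFun this (0, 0)
    simp at this
    linarith
  -- minimal closed set
  obtain ⟨S, ⟨hSc, hS0⟩, hmin⟩ : ∃ S : Finset Edge, (closedIn φ S ∧ chiS φ S (0, 0) = φ (0, 0)) ∧
      ∀ S' : Finset Edge, (closedIn φ S' ∧ chiS φ S' (0, 0) = φ (0, 0)) → S.card ≤ S'.card := by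
    have hne : ∃ n : ℕ, ∃ S : Finset Edge, (closedIn φ S ∧ chiS φ S (0, 0) = φ (0, 0)) ∧ S.card = n :=
      ⟨_, E, ⟨hEc, hEχ⟩, rfl⟩
    obtain ⟨S, hS, hc⟩ := Nat.find_spec hne
    refine ⟨S, hS, fun S' hS' => ?_⟩
    rw [hc]
    exact Nat.find_min' hne ⟨S', hS', rfl⟩
  have hwind : ∀ K ⊆ S, K.Nonempty → (∀ e ∈ K, ∀ f ∈ S, eadj e f → f ∈ K) →
      ∃ m : ℕ, m < S.card ∧ axE m ∈ K := by
    intro K hKS hKn hKc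
    have hK : closedIn φ K := ⟨fun e he => hSc.1 e (hKS he),
      fun e he f hf hef => hKc e he f (hSc.2 e (hKS he) f hf hef) hef⟩
    have hSK : closedIn φ (S \ K) := by
      refine ⟨fun e he => hSc.1 e (Finset.sdiff_subset he), fun e he f hf hef => ?_⟩
      rw [Finset.mem_sdiff] at he ⊢
      have hfS := hSc.2 e he.1 f hf hef
      exact ⟨hfS, fun hfK => he.2 (hKc f hfK e he.1 (eadj_symm hef))⟩
    have hadd : chiS φ (S \ K) (0, 0) + chiS φ K (0, 0) = chiS φ S (0, 0) := by
      simp only [chiS]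
      rw [← neg_add, Finset.sum_sdiff hKS]
    have hχK : chiS φ K (0, 0) ≠ 0 := by
      intro hz
      have h1 := hmin (S \ K) ⟨hSK, by rw [← hS0, ← hadd, hz, add_zero]⟩
      rw [Finset.card_sdiff_of_subset hKS] at h1
      have h2 := hKn.card_pos
      have h3 := Finset.card_le_card hKS
      omega
    obtain ⟨m, hm, hmK⟩ := axis_touch φ K hK hχK
    exact ⟨m, lt_of_lt_of_le hm (Finset.card_le_card hKS), hmK⟩
  have hSne : S.Nonempty := by
    rw [Finset.nonempty_iff_ne_empty]
    rintro rfl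
    apply h0
    rw [← hS0]
    simp [chiS]
  have hsupp : ∀ e, dd (chiS φ S) e ≠ 0 ↔ e ∈ S := by
    intro e
    rw [chi_d φ S hSc e]
    split_ifs with h
    · simp [h, hSc.1 e h]
    · simp [h]
  refine ⟨chiS φ S, chi_out hΛ φ hφ S hSc, hS0, ?_, S ∪ (Finset.range S.card).image axE, ?_, ?_, ?_⟩
  · intro e
    rw [chi_d φ S hSc e]
    split_ifs <;> simp
  · refine ⟨Finset.mem_union_right _ (Finset.mem_image_of_mem _ (by simp [hSne.card_pos])), ?_⟩
    intro A hA hA0 hAc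
    have hax : ∀ m : ℕ, m < S.card → axE m ∈ A := by
      intro m
      induction m with
      | zero => intro _; exact hA0
      | succ m ih =>
        intro hm
        refine hAc _ (ih (by omega)) _ (Finset.mem_union_right _
          (Finset.mem_image_of_mem _ (by simpa using hm))) ?_
        simp [eadj, axE]
    have hSA : S ⊆ A := by
      by_contra hns
      obtain ⟨m, hm, hmK⟩ := hwind (S \ A) Finset.sdiff_subset (by
        rwa [Finset.sdiff_nonempty]) (by
        intro e he f hf hef
        rw [Finset.mem_sdiff] at he ⊢
        exact ⟨hf, fun hfA => he.2 (hAc f hfA e (Finset.mem_union_left _ he.1) (eadj_symm hef))⟩)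
      exact (Finset.mem_sdiff.1 hmK).2 (hax m hm)
    apply Finset.Subset.antisymm hA
    apply Finset.union_subset hSA
    intro e he
    obtain ⟨m, hm, rfl⟩ := Finset.mem_image.1 he
    exact hax m (by simpa using hm)
  · intro e he
    exact Finset.mem_union_left _ ((hsupp e).1 he)
  · have h1 : (S ∪ (Finset.range S.card).image axE).filter (fun e => dd (chiS φ S) e ≠ 0) = S := by
      ext e
      simp only [Finset.mem_filter, hsupp]
      constructor
      · exact fun h => h.2
      · exact fun h => ⟨Finset.mem_union_left _ h, h⟩
    rw [h1]
    have h2 := Finset.card_union_le S ((Finset.range S.card).image axE)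
    have h3 : ((Finset.range S.card).image axE).card ≤ (Finset.range S.card).card := Finset.card_image_le
    rw [Finset.card_range] at h3
    omega

lemma pi_sum_le {ι : Type*} (g : ℤ → ℝ) (C : ℝ) (hg : ∀ m, 0 ≤ g m) (hC : ∀ M : Finset ℤ, ∑ m ∈ M, g m ≤ C)
    (T : Finset ι) : ∀ (F : Finset (ι → ℤ)), (∀ f ∈ F, ∀ i ∉ T, f i = 0) →
      ∑ f ∈ F, ∏ i ∈ T, g (f i) ≤ C ^ T.card := by
  have hC0 : 0 ≤ C := by simpa using hC ∅
  induction T using Finset.induction_on with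
  | empty =>
    intro F hF
    have : F ⊆ {0} := by
      intro f hf
      rw [Finset.mem_singleton]
      funext i
      exact hF f hf i (by simp)
    simp only [Finset.prod_empty, Finset.card_empty, pow_zero, Finset.sum_const, nsmul_eq_mul, mul_one]
    exact_mod_cast Finset.card_le_card this
  | insert a T ha ih =>
    intro F hF
    rw [Finset.card_insert_of_notMem ha, pow_succ']
    calc ∑ f ∈ F, ∏ i ∈ insert a T, g (f i)
        = ∑ f ∈ F, g (f a) * ∏ i ∈ T, g (f i) := by
          simp_rw [Finset.prod_insert ha]
      _ = ∑ m ∈ F.image (fun f => f a), ∑ f ∈ F with f a = m, g (f a) * ∏ i ∈ T, g (f i) := by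
          rw [Finset.sum_fiberwise_of_maps_to]
          intro f hf
          exact Finset.mem_image_of_mem _ hf
      _ ≤ ∑ m ∈ F.image (fun f => f a), g m * C ^ T.card := by
          apply Finset.sum_le_sum
          intro m _
          have h1 : ∑ f ∈ F with f a = m, g (f a) * ∏ i ∈ T, g (f i)
              = g m * ∑ f ∈ F with f a = m, ∏ i ∈ T, g (f i) := by
            rw [Finset.mul_sum]
            apply Finset.sum_congr rfl
            intro f hf
            rw [(Finset.mem_filter.1 hf).2]
          rw [h1]
          apply mul_le_mul_of_nonneg_left _ (hg m)
          have hinj : Set.InjOn (fun f : ι → ℤ => Function.update f a 0)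
              ((F.filter (fun f => f a = m) : Finset (ι → ℤ)) : Set (ι → ℤ)) := by
            intro f hf f' hf' hff
            simp only [Finset.coe_filter, Set.mem_ofPred_eq] at hf hf'
            funext i
            by_cases hi : i = a
            · subst hi; rw [hf.2, hf'.2]
            · have := congrFun hff i
              simpa [hi] using this
          have h2 := ih ((F.filter (fun f => f a = m)).image (fun f => Function.update f a 0)) (by
            intro f hf i hi
            obtain ⟨f', hf', rfl⟩ := Finset.mem_image.1 hf
            by_cases hia : i = a
            · subst hia; simp
            · simp only [Function.update_of_ne hia]
              exact hF f' (Finset.mem_filter.1 hf').1 i (by simp [hia, hi]))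
          rw [Finset.sum_image hinj] at h2
          refine le_trans (le_of_eq ?_) h2
          apply Finset.sum_congr rfl
          intro f _
          apply Finset.prod_congr rfl
          intro i hi
          rw [Function.update_of_ne]
          rintro rfl
          exact ha hi
      _ = (∑ m ∈ F.image (fun f => f a), g m) * C ^ T.card := by rw [Finset.sum_mul]
      _ ≤ C * C ^ T.card := by
          apply mul_le_mul_of_nonneg_right (hC _) (by positivity)

def nbr (e : Edge) : Finset Edge :=
  (Finset.Icc (e.1.1 - 1) (e.1.1 + 1) ×ˢ Finset.Icc (e.1.2 - 1) (e.1.2 + 1)) ×ˢ (Finset.univ : Finset Bool)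

lemma card_nbr (e : Edge) : (nbr e).card = 18 := by
  have h : ∀ z : ℤ, (z + 1 + 1 - (z - 1)).toNat = 3 := by
    intro z
    have : z + 1 + 1 - (z - 1) = 3 := by ring
    rw [this]; rfl
  simp [nbr, Finset.card_product, h]

lemma mem_nbr (e f : Edge) : f ∈ nbr e ↔ eadj e f := by
  simp only [nbr, eadj, Finset.mem_product, Finset.mem_Icc, Finset.mem_univ, and_true, abs_le]
  constructor
  · rintro ⟨⟨h1, h2⟩, h3, h4⟩; constructor <;> constructor <;> omega
  · rintro ⟨⟨h1, h2⟩, h3, h4⟩; constructor <;> constructor <;> omega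

def nb (T : Finset Edge) : Finset Edge := (T.biUnion nbr) \ T

lemma card_nb (T : Finset Edge) : T.card + (nb T).card ≤ 18 * T.card := by
  have h1 : T ⊆ T.biUnion nbr := by
    intro e he
    rw [Finset.mem_biUnion]
    exact ⟨e, he, by rw [mem_nbr]; simp [eadj]⟩
  have h2 : (T.biUnion nbr).card ≤ T.card * 18 :=
    Finset.card_biUnion_le_card_mul _ _ _ (fun e _ => (card_nbr e).le)
  have h3 := Finset.card_sdiff_add_card_eq_card h1
  unfold nb
  omega

lemma rooted_sub {T T' X : Finset Edge} (hT : rooted T) (hT' : rooted T')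
    (h1 : T ⊆ X) (h2 : ∀ e ∈ nb T', e ∉ X) : T ⊆ T' := by
  have := hT.2 (T ∩ T') Finset.inter_subset_left (Finset.mem_inter.2 ⟨hT.1, hT'.1⟩) (by
    intro a ha b hb hab
    rw [Finset.mem_inter] at ha ⊢
    refine ⟨hb, ?_⟩
    by_contra hbT
    refine h2 b ?_ (h1 hb)
    rw [nb, Finset.mem_sdiff, Finset.mem_biUnion]
    exact ⟨⟨a, ha.2, (mem_nbr _ _).2 hab⟩, hbT⟩)
  rw [← this]
  exact Finset.inter_subset_right

lemma rooted_sum (𝒯 : Finset (Finset Edge)) (h : ∀ T ∈ 𝒯, rooted T) :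
    ∑ T ∈ 𝒯, ((1 / 2 : ℝ) ^ 18) ^ T.card ≤ 1 := by
  set U : Finset Edge := 𝒯.biUnion (fun T => T ∪ nb T) with hU
  have hsub : ∀ T ∈ 𝒯, T ∪ nb T ⊆ U := fun T hT =>
    Finset.subset_biUnion_of_mem (fun T => T ∪ nb T) hT
  have hdisj : Set.PairwiseDisjoint (𝒯 : Set (Finset Edge)) (fun T => Finset.Icc T (U \ nb T)) := by
    intro T hT T' hT' hne
    rw [Function.onFun, Finset.disjoint_left]
    intro X hX hX'
    rw [Finset.mem_Icc] at hX hX'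
    apply hne
    apply Finset.Subset.antisymm
    · exact rooted_sub (h T hT) (h T' hT') hX.1 (fun e he heX => (Finset.mem_sdiff.1 (hX'.2 heX)).2 he)
    · exact rooted_sub (h T' hT') (h T hT) hX'.1 (fun e he heX => (Finset.mem_sdiff.1 (hX.2 heX)).2 he)
  have hcard : ∑ T ∈ 𝒯, (Finset.Icc T (U \ nb T)).card ≤ 2 ^ U.card := by
    rw [← Finset.card_biUnion hdisj, ← Finset.card_powerset]
    apply Finset.card_le_card
    intro X hX
    obtain ⟨T, hT, hXT⟩ := Finset.mem_biUnion.1 hX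
    rw [Finset.mem_powerset]
    exact (Finset.mem_Icc.1 hXT).2.trans Finset.sdiff_subset
  have hT : ∀ T ∈ 𝒯, ((1 / 2 : ℝ) ^ 18) ^ T.card * 2 ^ U.card ≤ ((Finset.Icc T (U \ nb T)).card : ℝ) := by
    intro T hT
    have h1 : T ⊆ U \ nb T := by
      intro e he
      rw [Finset.mem_sdiff]
      exact ⟨hsub T hT (Finset.mem_union_left _ he), fun h => (Finset.mem_sdiff.1 h).2 he⟩
    have h2 : nb T ⊆ U := Finset.subset_union_right.trans (hsub T hT)
    rw [Finset.card_Icc_finset h1, Finset.card_sdiff_of_subset h2]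
    have h3 := card_nb T
    have h4 : U.card ≤ 18 * T.card + (U.card - (nb T).card - T.card) := by omega
    rw [← pow_mul, one_div, inv_pow, inv_mul_le_iff₀ (by positivity)]
    push_cast
    rw [← pow_add]
    exact pow_le_pow_right₀ (by norm_num) h4
  have hfin : (∑ T ∈ 𝒯, ((1 / 2 : ℝ) ^ 18) ^ T.card) * 2 ^ U.card ≤ 1 * 2 ^ U.card := by
    rw [Finset.sum_mul, one_mul]
    refine (Finset.sum_le_sum hT).trans ?_
    exact_mod_cast hcard
  exact le_of_mul_le_mul_right hfin (by positivity)

/-- Polya averages -/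
def polyaA (χ : Site → ℤ) (n : ℕ) : ℝ :=
  (∑ q ∈ Finset.HasAntidiagonal.antidiagonal n, (χ ((q.1 : ℤ), (q.2 : ℤ)) : ℝ)) / (n + 1)

def polyaD (χ : Site → ℤ) (n : ℕ) : ℝ :=
  ∑ q ∈ Finset.HasAntidiagonal.antidiagonal n, ∑ b : Bool, |(dd χ (((q.1 : ℤ), (q.2 : ℤ)), b) : ℝ)|

lemma polya_step (χ : Site → ℤ) (n : ℕ) :
    polyaA χ n - polyaA χ (n + 1) ≤ polyaD χ n / (n + 1) := by
  have h1 : ((n : ℝ) + 1) * (∑ q ∈ Finset.HasAntidiagonal.antidiagonal (n + 1), (χ ((q.1 : ℤ), (q.2 : ℤ)) : ℝ))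
      = ∑ q ∈ Finset.HasAntidiagonal.antidiagonal n, (((q.1 : ℝ) + 1) * χ ((q.1 : ℤ) + 1, (q.2 : ℤ))
        + ((q.2 : ℝ) + 1) * χ ((q.1 : ℤ), (q.2 : ℤ) + 1)) := by
    have ha : ∑ q ∈ Finset.HasAntidiagonal.antidiagonal (n + 1), ((q.1 : ℝ) * (χ ((q.1 : ℤ), (q.2 : ℤ)) : ℝ))
        = ∑ q ∈ Finset.HasAntidiagonal.antidiagonal n, (((q.1 : ℝ) + 1) * χ ((q.1 : ℤ) + 1, (q.2 : ℤ))) := by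
      rw [Finset.Nat.sum_antidiagonal_succ]; simp
    have hb : ∑ q ∈ Finset.HasAntidiagonal.antidiagonal (n + 1), ((q.2 : ℝ) * (χ ((q.1 : ℤ), (q.2 : ℤ)) : ℝ))
        = ∑ q ∈ Finset.HasAntidiagonal.antidiagonal n, (((q.2 : ℝ) + 1) * χ ((q.1 : ℤ), (q.2 : ℤ) + 1)) := by
      rw [Finset.Nat.sum_antidiagonal_succ']; simp
    rw [Finset.sum_add_distrib, ← ha, ← hb, ← Finset.sum_add_distrib, Finset.mul_sum]
    apply Finset.sum_congr rfl
    intro q hq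
    have : q.1 + q.2 = n + 1 := Finset.HasAntidiagonal.mem_antidiagonal.1 hq
    have : (q.1 : ℝ) + q.2 = n + 1 := by exact_mod_cast this
    rw [← this]; ring
  have h2 : polyaA χ n - polyaA χ (n + 1) =
      (∑ q ∈ Finset.HasAntidiagonal.antidiagonal n, (((n : ℝ) + 2) * χ ((q.1 : ℤ), (q.2 : ℤ))
        - (((q.1 : ℝ) + 1) * χ ((q.1 : ℤ) + 1, (q.2 : ℤ))
        + ((q.2 : ℝ) + 1) * χ ((q.1 : ℤ), (q.2 : ℤ) + 1)))) / ((n + 2) * (n + 1)) := by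
    rw [Finset.sum_sub_distrib, ← h1, ← Finset.mul_sum]
    unfold polyaA
    push_cast
    field_simp
    ring
  rw [h2, ← div_div]
  apply div_le_div_of_nonneg_right _ (by positivity)
  rw [div_le_iff₀ (by positivity), polyaD, Finset.sum_mul]
  apply Finset.sum_le_sum
  intro q hq
  have h3 : q.1 + q.2 = n := Finset.HasAntidiagonal.mem_antidiagonal.1 hq
  have h4 : (q.1 : ℝ) + q.2 = n := by exact_mod_cast h3
  simp only [Fintype.sum_bool, dd_h, dd_v]
  push_cast
  set a := (χ ((q.1 : ℤ), (q.2 : ℤ)) : ℝ)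
  set b := (χ ((q.1 : ℤ) + 1, (q.2 : ℤ)) : ℝ)
  set c := (χ ((q.1 : ℤ), (q.2 : ℤ) + 1) : ℝ)
  have e1 : -|b - a| ≤ b - a := neg_abs_le _
  have e2 : -|c - a| ≤ c - a := neg_abs_le _
  have e3 := abs_nonneg (b - a)
  have e4 := abs_nonneg (c - a)
  have q1 : (0 : ℝ) ≤ q.1 := by positivity
  have q2 : (0 : ℝ) ≤ q.2 := by positivity
  rw [← h4]
  nlinarith [mul_nonneg q1 e4, mul_nonneg q2 e3, mul_nonneg q1 e3, mul_nonneg q2 e4,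
    mul_nonneg q1 (by linarith : 0 ≤ b - a + |b - a|), mul_nonneg q2 (by linarith : 0 ≤ c - a + |c - a|)]

lemma polya_sum {Λ : Finset Site} (χ : Site → ℤ) (hχ : ∀ x ∉ Λ, χ x = 0) :
    ∃ N : ℕ, (χ (0, 0) : ℝ) ≤ ∑ n ∈ Finset.range N, polyaD χ n / (n + 1) := by
  have h1 : ∀ N : ℕ, polyaA χ 0 - polyaA χ N ≤ ∑ n ∈ Finset.range N, polyaD χ n / (n + 1) := by
    intro N
    rw [← Finset.sum_range_sub' (polyaA χ) N]
    exact Finset.sum_le_sum fun n _ => polya_step χ n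
  set N := ∑ x ∈ Λ, (x.1.natAbs + x.2.natAbs) + 1 with hN
  have h2 : polyaA χ N = 0 := by
    unfold polyaA
    rw [Finset.sum_eq_zero, zero_div]
    intro q hq
    rw [hχ, Int.cast_zero]
    intro hm
    have := Finset.single_le_sum (f := fun x : Site => x.1.natAbs + x.2.natAbs) (fun i _ => by positivity) hm
    have h3 : q.1 + q.2 = N := Finset.HasAntidiagonal.mem_antidiagonal.1 hq
    simp at this
    omega
  have h3 : polyaA χ 0 = χ (0, 0) := by simp [polyaA]
  refine ⟨N, ?_⟩
  have := h1 N
  rw [h2, h3] at this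
  linarith

lemma energy_bound (p : ℝ) (hp1 : 1 < p) (hp2 : p < 2) : ∃ κ > (0 : ℝ), ∀ (Λ : Finset Site) (χ : Site → ℤ),
    (∀ x ∉ Λ, χ x = 0) → ∀ h : ℕ, χ (0, 0) = h → κ * (h : ℝ) ^ p ≤ HE p χ := by
  set q := p / (p - 1) with hq
  have hpq : p.HolderConjugate q := Real.HolderConjugate.conjExponent hp1
  have hq2 : 2 < q := by
    rw [hq, lt_div_iff₀ (by linarith)]; linarith
  have hsum : Summable (fun n : ℕ => 2 * ((n + 1 : ℕ) : ℝ) ^ (1 - q)) := by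
    apply Summable.mul_left
    exact (summable_nat_add_iff 1).2 (Real.summable_nat_rpow.2 (by linarith))
  set K := ∑' n : ℕ, 2 * ((n + 1 : ℕ) : ℝ) ^ (1 - q) with hK
  have hKpos : 0 < K := hsum.tsum_pos (fun n => by positivity) 0 (by simp)
  refine ⟨(K ^ (p / q))⁻¹, by positivity, ?_⟩
  intro Λ χ hχ h hh
  obtain ⟨N, hN⟩ := polya_sum χ hχ
  obtain ⟨E, hE⟩ := dd_fin Λ hχ
  set J := (Finset.range N).sigma (fun n => Finset.HasAntidiagonal.antidiagonal n ×ˢ (Finset.univ : Finset Bool)) with hJ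
  set ed : (Σ _ : ℕ, (ℕ × ℕ) × Bool) → Edge := fun j => (((j.2.1.1 : ℤ), (j.2.1.2 : ℤ)), j.2.2) with hed
  have h1 : ∑ n ∈ Finset.range N, polyaD χ n / (n + 1) =
      ∑ j ∈ J, |(dd χ (ed j) : ℝ)| * ((j.1 : ℝ) + 1)⁻¹ := by
    rw [hJ, Finset.sum_sigma]
    apply Finset.sum_congr rfl
    intro n _
    rw [Finset.sum_product, polyaD, div_eq_mul_inv, Finset.sum_mul]
    apply Finset.sum_congr rfl
    intro q _
    rw [Finset.sum_mul]
  have h2 := Real.inner_le_Lp_mul_Lq_of_nonneg J (f := fun j => |(dd χ (ed j) : ℝ)|)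
    (g := fun j => ((j.1 : ℝ) + 1)⁻¹) hpq (fun _ _ => abs_nonneg _) (fun _ _ => by positivity)
  have h3 : ∑ j ∈ J, |(dd χ (ed j) : ℝ)| ^ p ≤ HE p χ := by
    have hs := HE_summable hp1 (fun e he => (hE e).2 he)
    have hinj : Set.InjOn ed (J : Set _) := by
      rintro ⟨n, ⟨a, b⟩, c⟩ hj ⟨n', ⟨a', b'⟩, c'⟩ hj' hjj
      simp only [hJ, Finset.mem_coe, Finset.mem_sigma, Finset.mem_product, Finset.HasAntidiagonal.mem_antidiagonal] at hj hj'
      simp only [hed, Prod.mk.injEq, Nat.cast_inj] at hjj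
      obtain ⟨⟨rfl, rfl⟩, rfl⟩ := hjj
      obtain rfl : n = n' := by rw [← hj.2.1, ← hj'.2.1]
      rfl
    have : ∑ j ∈ J, |(dd χ (ed j) : ℝ)| ^ p = ∑ e ∈ J.image ed, VV p (dd χ e) := by
      rw [Finset.sum_image hinj]
      apply Finset.sum_congr rfl
      intro j _
      simp [VV]
    rw [this]
    exact hs.sum_le_tsum _ (fun _ _ => VV_nonneg _ _)
  have h4 : ∑ j ∈ J, (((j.1 : ℝ) + 1)⁻¹) ^ q ≤ K := by
    have : ∑ j ∈ J, (((j.1 : ℝ) + 1)⁻¹) ^ q = ∑ n ∈ Finset.range N, 2 * ((n + 1 : ℕ) : ℝ) ^ (1 - q) := by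
      rw [hJ, Finset.sum_sigma]
      apply Finset.sum_congr rfl
      intro n _
      have hn : (0 : ℝ) < (n : ℝ) + 1 := by positivity
      simp only [Finset.sum_const, Finset.card_product, Finset.Nat.card_antidiagonal, Finset.card_univ,
        Fintype.card_bool, nsmul_eq_mul]
      push_cast
      rw [Real.rpow_sub hn, Real.rpow_one, Real.inv_rpow hn.le]
      field_simp
    rw [this]
    exact hsum.sum_le_tsum _ (fun _ _ => by positivity)
  have h5 : (h : ℝ) ≤ (HE p χ) ^ (1 / p) * K ^ (1 / q) := by
    rw [hh] at hN
    rw [h1] at hN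
    have hA : (0 : ℝ) ≤ ∑ j ∈ J, |(dd χ (ed j) : ℝ)| ^ p := by positivity
    have hB : (0 : ℝ) ≤ ∑ j ∈ J, (((j.1 : ℝ) + 1)⁻¹) ^ q := by positivity
    have hqp : 0 < q := by linarith
    have hHp : 0 ≤ (HE p χ) ^ (1 / p) := Real.rpow_nonneg (HE_nonneg p χ) _
    calc (h : ℝ) ≤ _ := by exact_mod_cast hN
      _ ≤ _ := h2
      _ ≤ _ := by gcongr
  have hH := HE_nonneg p χ
  have h6 : (h : ℝ) ^ p ≤ HE p χ * K ^ (p / q) := by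
    calc (h : ℝ) ^ p ≤ ((HE p χ) ^ (1 / p) * K ^ (1 / q)) ^ p := by
          apply Real.rpow_le_rpow (by positivity) h5 (by linarith)
      _ = _ := by
          rw [Real.mul_rpow (by positivity) (by positivity), ← Real.rpow_mul hH, ← Real.rpow_mul hKpos.le,
            one_div_mul_cancel (by linarith), Real.rpow_one]
          congr 2
          ring
  rw [inv_mul_le_iff₀ (by positivity)]
  linarith

lemma chi_full {Λ : Finset Site} (hΛ : rayLam Λ) (φ : Site → ℤ) (hφ : ∀ x ∉ Λ, φ x = 0)
    (E : Finset Edge) (hE : ∀ e, e ∈ E ↔ dd φ e ≠ 0) (x : Site) : chiS φ E x = φ x := by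
  have hEc : closedIn φ E := ⟨fun e he => (hE e).1 he, fun e _ f hf _ => (hE f).2 hf⟩
  have := dd_unique (Λ := Λ) (fun x => chiS φ E x - φ x)
    (fun x hx => by simp [chi_out hΛ φ hφ E hEc x hx, hφ x hx]) (by
      intro e
      have h1 := chi_d φ E hEc e
      have h2 : dd (fun x => chiS φ E x - φ x) e = dd (chiS φ E) e - dd φ e := by
        simp only [dd]; ring
      rw [h2, h1]
      split_ifs with h
      · simp
      · have : dd φ e = 0 := by
          by_contra h'
          exact h ((hE e).2 h')
        simp [this])
  have := congrFun this x
  simp at this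
  linarith

lemma abs_le_HE {p : ℝ} (hp : 1 < p) {Λ : Finset Site} (hΛ : rayLam Λ) (φ : Site → ℤ)
    (hφ : ∀ x ∉ Λ, φ x = 0) (x : Site) : ((|φ x| : ℤ) : ℝ) ≤ HE p φ := by
  obtain ⟨E, hE⟩ := dd_fin Λ hφ
  rw [HE_eq_sum hp (fun e he => (hE e).2 he)]
  have h1 : |φ x| ≤ ∑ e ∈ E, |dd φ e| := by
    rw [← chi_full hΛ φ hφ E hE x, chiS, abs_neg]
    refine (Finset.abs_sum_le_sum_abs _ _).trans (Finset.sum_le_sum fun e _ => ?_)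
    split_ifs <;> simp
  calc ((|φ x| : ℤ) : ℝ) ≤ ((∑ e ∈ E, |dd φ e| : ℤ) : ℝ) := by exact_mod_cast h1
    _ = ∑ e ∈ E, ((|dd φ e| : ℤ) : ℝ) := by rw [Int.cast_sum]
    _ ≤ _ := Finset.sum_le_sum fun e _ => VV_ge hp _

lemma summable_exp_int {a : ℝ} (ha : 0 < a) : Summable (fun m : ℤ => Real.exp (-a * ((|m| : ℤ) : ℝ))) := by
  have h := (Real.summable_exp_nat_mul_iff (a := -a)).2 (by linarith)
  apply Summable.of_nat_of_neg
  · refine h.congr fun n => ?_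
    congr 1; simp; ring
  · refine h.congr fun n => ?_
    congr 1; simp; ring

def GG (p β : ℝ) (Λ : Finset Site) (k : ℤ) (φ : Site → ℤ) : ℝ :=
  if (∀ x ∉ Λ, φ x = 0) ∧ φ (0, 0) = k then Real.exp (-β * HE p φ) else 0

def WW (p β : ℝ) (Λ : Finset Site) (k : ℤ) : ℝ := ∑' φ : Site → ℤ, GG p β Λ k φ

lemma GG_nonneg (p β : ℝ) (Λ : Finset Site) (k : ℤ) (φ : Site → ℤ) : 0 ≤ GG p β Λ k φ := by
  unfold GG; split_ifs <;> positivity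

lemma pW_eq {p : ℝ} (hp : 1 < p) (β : ℝ) (Λ : Finset Site) (k : ℤ) :
    pW p β Λ (fun η => η (0, 0) = k) = WW p β Λ k := by
  unfold pW WW
  apply tsum_congr
  intro φ
  unfold GG
  by_cases h : (∀ x ∉ Λ, φ x = 0) ∧ φ (0, 0) = k
  · obtain ⟨E, hE⟩ := dd_fin Λ h.1
    rw [if_pos h, if_pos h, pH_eq hp (fun e he => (hE e).2 he)]
  · rw [if_neg h, if_neg h]

lemma GG_summable {p β : ℝ} (hp : 1 < p) (hβ : 0 < β) {Λ : Finset Site} (hΛ : rayLam Λ) (k : ℤ) :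
    Summable (GG p β Λ k) := by
  set a := β / (Λ.card + 1) with ha
  have hapos : 0 < a := by positivity
  set g : ℤ → ℝ := fun m => Real.exp (-a * ((|m| : ℤ) : ℝ)) with hg
  have hgs : Summable g := summable_exp_int hapos
  apply summable_of_sum_le (c := (∑' m, g m) ^ Λ.card) (fun φ => GG_nonneg _ _ _ _ _)
  intro u
  calc ∑ φ ∈ u, GG p β Λ k φ
      = ∑ φ ∈ u with ((∀ x ∉ Λ, φ x = 0) ∧ φ (0, 0) = k), Real.exp (-β * HE p φ) := by
        rw [Finset.sum_filter]; rfl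
    _ ≤ ∑ φ ∈ u with ((∀ x ∉ Λ, φ x = 0) ∧ φ (0, 0) = k), ∏ x ∈ Λ, g (φ x) := by
        apply Finset.sum_le_sum
        intro φ hφ
        have hφ' := (Finset.mem_filter.1 hφ).2.1
        rw [← Real.exp_sum, Real.exp_le_exp, ← Finset.mul_sum]
        have h1 : ∑ x ∈ Λ, ((|φ x| : ℤ) : ℝ) ≤ Λ.card * HE p φ := by
          rw [← nsmul_eq_mul]
          exact Finset.sum_le_card_nsmul _ _ _ fun x _ => abs_le_HE hp hΛ φ hφ' x
        have h2 : β * HE p φ = a * ((Λ.card + 1) * HE p φ) := by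
          rw [ha]; field_simp
        have h3 := HE_nonneg p φ
        have h4 : a * ∑ x ∈ Λ, ((|φ x| : ℤ) : ℝ) ≤ a * ((Λ.card + 1) * HE p φ) := by
          apply mul_le_mul_of_nonneg_left _ hapos.le
          linarith
        linarith
    _ ≤ _ := by
        apply pi_sum_le g _ (fun m => (Real.exp_pos _).le)
          (fun M => hgs.sum_le_tsum _ (fun _ _ => (Real.exp_pos _).le))
        intro f hf
        exact (Finset.mem_filter.1 hf).2.1

lemma GG_dec (p β : ℝ) (Λ : Finset Site) (k : ℤ) (φ : Site → ℤ) (h1 : ∀ x ∉ Λ, φ x = 0)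
    (h2 : φ (0, 0) = k) : GG p β Λ k φ = Real.exp (-β * HE p φ) := if_pos ⟨h1, h2⟩

lemma WW_pos {p β : ℝ} (hp : 1 < p) (hβ : 0 < β) {Λ : Finset Site} (hΛ : rayLam Λ)
    (h0 : ((0, 0) : Site) ∈ Λ) (k : ℤ) : 0 < WW p β Λ k := by
  refine (GG_summable hp hβ hΛ k).tsum_pos (GG_nonneg _ _ _ _)
    (fun x => if x = (0, 0) then k else 0) ?_
  have : GG p β Λ k (fun x => if x = (0, 0) then k else 0) = Real.exp _ :=
    GG_dec p β Λ k (fun x => if x = (0, 0) then k else 0) (by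
      intro x hx
      exact if_neg (by rintro rfl; exact hx h0)) (by simp)
  rw [this]
  exact Real.exp_pos _

/-- convexity -/
lemma conv_abs {p : ℝ} (hp : 1 < p) (x y s t : ℝ) (hs : 0 ≤ s) (ht : 0 ≤ t) (hst : s + t = 1) :
    |s * x + t * y| ^ p ≤ s * |x| ^ p + t * |y| ^ p := by
  have h := (convexOn_rpow hp.le).2 (x := |x|) (y := |y|) (Set.mem_Ici.2 (abs_nonneg _)) (Set.mem_Ici.2 (abs_nonneg _)) hs ht hst
  simp only [smul_eq_mul] at h
  refine le_trans ?_ h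
  apply Real.rpow_le_rpow (abs_nonneg _) _ (by linarith)
  calc |s * x + t * y| ≤ |s * x| + |t * y| := abs_add_le _ _
    _ = _ := by rw [abs_mul, abs_mul, abs_of_nonneg hs, abs_of_nonneg ht]

lemma VV_maj {p : ℝ} (hp : 1 < p) (u v s t : ℤ) (h : s + t = u + v) (h1 : s ≤ u) (h2 : v ≤ s) :
    VV p s + VV p t ≤ VV p u + VV p v := by
  rcases eq_or_lt_of_le (h2.trans h1) with huv | huv
  · have : s = u := by omega
    have : t = v := by omega
    subst_vars; rfl
  · have hd : (0 : ℝ) < (u : ℝ) - v := by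
      have : (v : ℝ) < u := by exact_mod_cast huv
      linarith
    have h1' : (s : ℝ) ≤ u := by exact_mod_cast h1
    have h2' : (v : ℝ) ≤ s := by exact_mod_cast h2
    have h' : (s : ℝ) + t = u + v := by exact_mod_cast h
    set θ : ℝ := ((s : ℝ) - v) / (u - v) with hθ
    have hθ0 : 0 ≤ θ := div_nonneg (by linarith) hd.le
    have hθ1 : θ ≤ 1 := by rw [hθ, div_le_one hd]; linarith
    have hm : θ * ((u : ℝ) - v) = s - v := by rw [hθ]; field_simp
    have e1 : (s : ℝ) = θ * u + (1 - θ) * v := by linarith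
    have e2 : (t : ℝ) = (1 - θ) * u + θ * v := by linarith
    have c1 := conv_abs hp u v θ (1 - θ) hθ0 (by linarith) (by ring)
    have c2 := conv_abs hp u v (1 - θ) θ (by linarith) hθ0 (by ring)
    rw [← e1] at c1
    rw [← e2] at c2
    simp only [VV, Int.cast_abs]
    linarith

lemma VV_submod {p : ℝ} (hp : 1 < p) (a b c d : ℤ) :
    VV p ((a ⊓ b) - (c ⊓ d)) + VV p ((a ⊔ b) - (c ⊔ d)) ≤ VV p (a - c) + VV p (b - d) := by
  rcases le_total a b with h1 | h1 <;> rcases le_total c d with h2 | h2 <;>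
    simp only [h1, h2, inf_of_le_left, inf_of_le_right, sup_of_le_left, sup_of_le_right]
  · rfl
  · rw [add_comm (VV p (a - c))]
    apply VV_maj hp <;> omega
  · apply VV_maj hp <;> omega
  · rw [add_comm]

lemma dd_add_one (a : Site → ℤ) (e : Edge) : dd (fun x => a x + 1) e = dd a e := by
  simp [dd]

lemma HE_submod {p : ℝ} (hp : 1 < p) {Λ : Finset Site} (a b : Site → ℤ)
    (h1 : ∀ x ∉ Λ, a x + 1 = 0) (h2 : ∀ x ∉ Λ, b x = 0)
    (h3 : ∀ x ∉ Λ, (a ⊓ b) x + 1 = 0) (h4 : ∀ x ∉ Λ, (a ⊔ b) x = 0) :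
    HE p (fun x => (a ⊓ b) x + 1) + HE p (a ⊔ b) ≤ HE p (fun x => a x + 1) + HE p b := by
  obtain ⟨E1, hE1⟩ := dd_fin (φ := fun x => a x + 1) Λ h1
  obtain ⟨E2, hE2⟩ := dd_fin Λ h2
  obtain ⟨E3, hE3⟩ := dd_fin (φ := fun x => (a ⊓ b) x + 1) Λ h3
  obtain ⟨E4, hE4⟩ := dd_fin Λ h4
  have t1 := HE_summable hp (fun e he => (hE1 e).2 he)
  have t2 := HE_summable hp (fun e he => (hE2 e).2 he)
  have t3 := HE_summable hp (fun e he => (hE3 e).2 he)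
  have t4 := HE_summable hp (fun e he => (hE4 e).2 he)
  unfold HE
  rw [← t3.tsum_add t4, ← t1.tsum_add t2]
  apply (t3.add t4).tsum_le_tsum _ (t1.add t2)
  intro e
  rw [dd_add_one, dd_add_one]
  exact VV_submod hp _ _ _ _

lemma key_ff {p β : ℝ} (hp : 1 < p) (hβ : 0 < β) {Λ : Finset Site} (k : ℤ) (a b : Site → ℤ) :
    GG p β Λ (k + 1) (fun x => a x + 1) * GG p β Λ (k - 1) b ≤
      GG p β Λ k (fun x => (a ⊓ b) x + 1) * GG p β Λ k (a ⊔ b) := by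
  have hR : 0 ≤ GG p β Λ k (fun x => (a ⊓ b) x + 1) * GG p β Λ k (a ⊔ b) :=
    mul_nonneg (GG_nonneg _ _ _ _ _) (GG_nonneg _ _ _ _ _)
  by_cases ha : (∀ x ∉ Λ, a x + 1 = 0) ∧ a (0, 0) + 1 = k + 1
  swap
  · rw [show GG p β Λ (k + 1) (fun x => a x + 1) = 0 from if_neg ha, zero_mul]; exact hR
  by_cases hb : (∀ x ∉ Λ, b x = 0) ∧ b (0, 0) = k - 1
  swap
  · rw [show GG p β Λ (k - 1) b = 0 from if_neg hb, mul_zero]; exact hR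
  have hm1 : ∀ x ∉ Λ, (a ⊓ b) x + 1 = 0 := by
    intro x hx
    have h1 := ha.1 x hx
    have h2 := hb.1 x hx
    simp only [Pi.inf_apply]
    omega
  have hm2 : (a ⊓ b) (0, 0) + 1 = k := by
    have h1 := ha.2
    have h2 := hb.2
    simp only [Pi.inf_apply]
    omega
  have hj1 : ∀ x ∉ Λ, (a ⊔ b) x = 0 := by
    intro x hx
    have h1 := ha.1 x hx
    have h2 := hb.1 x hx
    simp only [Pi.sup_apply]
    omega
  have hj2 : (a ⊔ b) (0, 0) = k := by
    have h1 := ha.2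
    have h2 := hb.2
    simp only [Pi.sup_apply]
    omega
  rw [GG_dec p β Λ (k + 1) (fun x => a x + 1) ha.1 ha.2, GG_dec p β Λ _ b hb.1 hb.2,
    GG_dec p β Λ k (fun x => (a ⊓ b) x + 1) hm1 hm2,
    GG_dec p β Λ k (a ⊔ b) hj1 hj2, ← Real.exp_add, ← Real.exp_add, Real.exp_le_exp]
  have := mul_le_mul_of_nonneg_left (HE_submod hp a b ha.1 hb.1 hm1 hj1) hβ.le
  linarith

lemma ff_tsum (f1 f2 f3 f4 : (Site → ℤ) → ℝ) (n1 : ∀ x, 0 ≤ f1 x) (n2 : ∀ x, 0 ≤ f2 x)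
    (n3 : ∀ x, 0 ≤ f3 x) (n4 : ∀ x, 0 ≤ f4 x)
    (s1 : Summable f1) (s2 : Summable f2) (s3 : Summable f3) (s4 : Summable f4)
    (key : ∀ a b, f1 a * f2 b ≤ f3 (a ⊓ b) * f4 (a ⊔ b)) :
    (∑' a, f1 a) * (∑' a, f2 a) ≤ (∑' a, f3 a) * (∑' a, f4 a) := by
  have hlim : Tendsto (fun st : Finset (Site → ℤ) × Finset (Site → ℤ) =>
      (∑ a ∈ st.1, f1 a) * ∑ b ∈ st.2, f2 b)
      (atTop ×ˢ atTop) (𝓝 ((∑' φ, f1 φ) * ∑' φ, f2 φ)) := by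
    apply Tendsto.mul
    · exact s1.hasSum.comp tendsto_fst
    · exact s2.hasSum.comp tendsto_snd
  refine le_of_tendsto' hlim ?_
  rintro ⟨s, t⟩
  have h := four_functions_theorem f1 f2 f3 f4 n1 n2 n3 n4 key s t
  refine h.trans ?_
  apply mul_le_mul
  · exact s3.sum_le_tsum _ (fun _ _ => n3 _)
  · exact s4.sum_le_tsum _ (fun _ _ => n4 _)
  · exact Finset.sum_nonneg (fun _ _ => n4 _)
  · exact tsum_nonneg n3

lemma logconc {p β : ℝ} (hp : 1 < p) (hβ : 0 < β) {Λ : Finset Site} (hΛ : rayLam Λ) (k : ℤ) :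
    WW p β Λ (k + 1) * WW p β Λ (k - 1) ≤ WW p β Λ k * WW p β Λ k := by
  obtain ⟨sh, hsh⟩ : ∃ sh : (Site → ℤ) ≃ (Site → ℤ), ∀ c, sh c = fun x => c x + 1 :=
    ⟨Equiv.addRight (fun _ => 1), fun _ => rfl⟩
  have hs1 := GG_summable hp hβ hΛ (k + 1)
  have hs2 := GG_summable hp hβ hΛ (k - 1)
  have hs3 := GG_summable hp hβ hΛ k
  have e : ∀ j, WW p β Λ j = ∑' φ : Site → ℤ, GG p β Λ j (fun x => φ x + 1) := by
    intro j
    unfold WW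
    rw [← sh.tsum_eq (GG p β Λ j)]
    simp only [hsh]
  have hs : ∀ j, Summable (fun φ : Site → ℤ => GG p β Λ j (fun x => φ x + 1)) := by
    intro j
    have h := (sh.summable_iff (f := GG p β Λ j)).2 (GG_summable hp hβ hΛ j)
    refine h.congr fun φ => ?_
    simp only [Function.comp, hsh]
  have h := ff_tsum (fun φ => GG p β Λ (k + 1) (fun x => φ x + 1)) (GG p β Λ (k - 1))
    (fun φ => GG p β Λ k (fun x => φ x + 1)) (GG p β Λ k)
    (fun _ => GG_nonneg _ _ _ _ _) (fun _ => GG_nonneg _ _ _ _ _)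
    (fun _ => GG_nonneg _ _ _ _ _) (fun _ => GG_nonneg _ _ _ _ _)
    (hs _) hs2 (hs _) hs3 (key_ff hp hβ k)
  rw [← e, ← e] at h
  exact h

lemma mem_ball_iff (L : ℕ) (x : Site) : x ∈ ball (L : ℝ) ↔ x.1 ^ 2 + x.2 ^ 2 ≤ (L : ℤ) ^ 2 := by
  have hc : ⌈((L : ℕ) : ℝ)⌉ = (L : ℤ) := by simp
  unfold ball
  rw [Finset.mem_filter, Finset.mem_product, hc, Finset.mem_Icc, Finset.mem_Icc]
  constructor
  · rintro ⟨_, h⟩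
    exact_mod_cast h
  · intro h
    have hL : (0 : ℤ) ≤ L := by positivity
    refine ⟨⟨abs_le.1 (abs_le_of_sq_le_sq (by nlinarith [sq_nonneg x.2]) hL),
      abs_le.1 (abs_le_of_sq_le_sq (by nlinarith [sq_nonneg x.1]) hL)⟩, ?_⟩
    exact_mod_cast h

lemma ray_ball (L : ℕ) : rayLam (ball (L : ℝ)) := by
  intro x hx
  rw [mem_ball_iff] at hx
  rcases le_total 0 x.1 with h | h
  · left
    intro k hk hm
    rw [mem_ball_iff] at hm
    apply hx
    simp only at hm
    nlinarith
  · right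
    intro k hk hm
    rw [mem_ball_iff] at hm
    apply hx
    simp only at hm
    nlinarith

def KK : ℝ := ∑' m : ℤ, Real.exp (-1 * ((|m| : ℤ) : ℝ))

lemma exp_half_bound {p β : ℝ} (hp : 1 < p) (hβ : 0 < β) (χ : Site → ℤ) (T : Finset Edge)
    (hT : goodT χ T) :
    Real.exp (-(β / 2) * HE p χ) ≤
      ∏ e ∈ T, (Real.exp (-β / 8) * Real.exp (-(β / 4) * ((|dd χ e| : ℤ) : ℝ))) := by
  obtain ⟨_, h2, h3⟩ := hT
  rw [Finset.prod_mul_distrib, Finset.prod_const, ← Real.exp_nat_mul, ← Real.exp_sum,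
    ← Real.exp_add, Real.exp_le_exp, ← Finset.mul_sum, HE_eq_sum hp h2]
  have a1 : ∑ e ∈ T, ((|dd χ e| : ℤ) : ℝ) ≤ ∑ e ∈ T, VV p (dd χ e) :=
    Finset.sum_le_sum fun e _ => VV_ge hp _
  have a2 : ((T.filter (fun e => dd χ e ≠ 0)).card : ℝ) ≤ ∑ e ∈ T, ((|dd χ e| : ℤ) : ℝ) := by
    rw [Finset.card_filter, Nat.cast_sum]
    apply Finset.sum_le_sum
    intro e _
    split_ifs with h
    · have := Int.one_le_abs h
      exact_mod_cast this
    · simp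
  have a3 : (T.card : ℝ) ≤ 2 * ((T.filter (fun e => dd χ e ≠ 0)).card : ℝ) := by
    exact_mod_cast h3
  have a4 : β * ∑ e ∈ T, ((|dd χ e| : ℤ) : ℝ) ≤ β * ∑ e ∈ T, VV p (dd χ e) :=
    mul_le_mul_of_nonneg_left a1 hβ.le
  have a5 : β * (T.card : ℝ) ≤ β * (2 * ∑ e ∈ T, VV p (dd χ e)) :=
    mul_le_mul_of_nonneg_left (by linarith) hβ.le
  linarith

lemma dd_inj {Λ : Finset Site} (a b : Site → ℤ) (ha : ∀ x ∉ Λ, a x = 0) (hb : ∀ x ∉ Λ, b x = 0)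
    (h : dd a = dd b) : a = b := by
  have := dd_unique (Λ := Λ) (fun x => a x - b x) (fun x hx => by simp [ha x hx, hb x hx]) (by
    intro e
    have h1 := congrFun h e
    simp only [dd] at h1 ⊢
    omega)
  funext x
  have := congrFun this x
  simp at this
  omega

lemma peierls_half {p β : ℝ} (hp : 1 < p) (hβ : 4 ≤ β) (hK : Real.exp (-β / 8) * KK ≤ (1 / 2) ^ 18)
    {Λ : Finset Site} (G : Finset (Site → ℤ)) (h1 : ∀ χ ∈ G, ∀ x ∉ Λ, χ x = 0)
    (h2 : ∀ χ ∈ G, ∃ T, goodT χ T) :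
    ∑ χ ∈ G, Real.exp (-(β / 2) * HE p χ) ≤ 1 := by
  set g : ℤ → ℝ := fun m => Real.exp (-β / 8) * Real.exp (-(β / 4) * ((|m| : ℤ) : ℝ)) with hg
  have hg0 : ∀ m, 0 ≤ g m := fun m => by rw [hg]; positivity
  have hgC : ∀ M : Finset ℤ, ∑ m ∈ M, g m ≤ Real.exp (-β / 8) * KK := by
    intro M
    rw [hg, ← Finset.mul_sum]
    apply mul_le_mul_of_nonneg_left _ (Real.exp_pos _).le
    refine le_trans (Finset.sum_le_sum (g := fun m : ℤ => Real.exp (-1 * ((|m| : ℤ) : ℝ))) ?_)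
      ((summable_exp_int one_pos).sum_le_tsum _ (fun _ _ => (Real.exp_pos _).le))
    intro m _
    rw [Real.exp_le_exp]
    have : (0 : ℝ) ≤ ((|m| : ℤ) : ℝ) := by exact_mod_cast abs_nonneg m
    nlinarith
  have hC0 : 0 ≤ Real.exp (-β / 8) * KK := by simpa using hgC ∅
  have hτ : ∃ τ : (Site → ℤ) → Finset Edge, ∀ χ ∈ G, goodT χ (τ χ) := by
    choose! τ hτ using h2
    exact ⟨τ, hτ⟩
  obtain ⟨τ, hτ⟩ := hτ
  calc ∑ χ ∈ G, Real.exp (-(β / 2) * HE p χ)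
      ≤ ∑ χ ∈ G, ∏ e ∈ τ χ, g (dd χ e) :=
        Finset.sum_le_sum fun χ hχ => exp_half_bound hp (by linarith) χ _ (hτ χ hχ)
    _ = ∑ T ∈ G.image τ, ∑ χ ∈ G with τ χ = T, ∏ e ∈ τ χ, g (dd χ e) :=
        (Finset.sum_fiberwise_of_maps_to (fun χ hχ => Finset.mem_image_of_mem _ hχ) _).symm
    _ ≤ ∑ T ∈ G.image τ, ((1 / 2 : ℝ) ^ 18) ^ T.card := by
        apply Finset.sum_le_sum
        intro T _
        have e1 : ∑ χ ∈ G with τ χ = T, ∏ e ∈ τ χ, g (dd χ e)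
            = ∑ f ∈ (G.filter (fun χ => τ χ = T)).image dd, ∏ e ∈ T, g (f e) := by
          rw [Finset.sum_image]
          · apply Finset.sum_congr rfl
            intro χ hχ
            rw [(Finset.mem_filter.1 hχ).2]
          · intro a ha b hb hab
            exact dd_inj a b (h1 a (Finset.mem_filter.1 ha).1) (h1 b (Finset.mem_filter.1 hb).1) hab
        rw [e1]
        refine le_trans (pi_sum_le g _ hg0 hgC T _ ?_) (pow_le_pow_left₀ hC0 hK _)
        intro f hf e he
        obtain ⟨χ, hχ, rfl⟩ := Finset.mem_image.1 hf
        obtain ⟨hχ1, hχ2⟩ := Finset.mem_filter.1 hχ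
        by_contra h
        exact he (hχ2 ▸ (hτ χ hχ1).2.1 e h)
    _ ≤ 1 := by
        apply rooted_sum
        intro T hT
        obtain ⟨χ, hχ, rfl⟩ := Finset.mem_image.1 hT
        exact (hτ χ hχ).1

lemma peierls_sum {p β κ : ℝ} (hp : 1 < p) (hβ : 4 ≤ β)
    (hK : Real.exp (-β / 8) * KK ≤ (1 / 2) ^ 18)
    (hκ : ∀ (Λ : Finset Site) (χ : Site → ℤ), (∀ x ∉ Λ, χ x = 0) → ∀ h : ℕ, χ (0, 0) = h →
      κ * (h : ℝ) ^ p ≤ HE p χ)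
    {Λ : Finset Site} (h : ℕ) (G : Finset (Site → ℤ)) (h1 : ∀ χ ∈ G, ∀ x ∉ Λ, χ x = 0)
    (h0 : ∀ χ ∈ G, χ (0, 0) = (h : ℤ)) (h2 : ∀ χ ∈ G, ∃ T, goodT χ T) :
    ∑ χ ∈ G, Real.exp (-β * HE p χ) ≤ Real.exp (-(β / 2) * (κ * (h : ℝ) ^ p)) := by
  calc ∑ χ ∈ G, Real.exp (-β * HE p χ)
      ≤ ∑ χ ∈ G, Real.exp (-(β / 2) * (κ * (h : ℝ) ^ p)) * Real.exp (-(β / 2) * HE p χ) := by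
        apply Finset.sum_le_sum
        intro χ hχ
        rw [← Real.exp_add, Real.exp_le_exp]
        have := hκ Λ χ (h1 χ hχ) h (h0 χ hχ)
        nlinarith
    _ = Real.exp (-(β / 2) * (κ * (h : ℝ) ^ p)) * ∑ χ ∈ G, Real.exp (-(β / 2) * HE p χ) := by
        rw [Finset.mul_sum]
    _ ≤ Real.exp (-(β / 2) * (κ * (h : ℝ) ^ p)) * 1 :=
        mul_le_mul_of_nonneg_left (peierls_half hp hβ hK G h1 h2) (Real.exp_pos _).le
    _ = _ := mul_one _

lemma HE_split {p : ℝ} (hp : 1 < p) {Λ : Finset Site} (φ χ : Site → ℤ) (h1 : ∀ x ∉ Λ, φ x = 0)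
    (h2 : ∀ x ∉ Λ, χ x = 0) (h : ∀ e, dd χ e = 0 ∨ dd χ e = dd φ e) :
    HE p φ = HE p χ + HE p (fun x => φ x - χ x) := by
  have h3 : ∀ x ∉ Λ, (fun x => φ x - χ x) x = 0 := fun x hx => by simp [h1 x hx, h2 x hx]
  obtain ⟨E2, hE2⟩ := dd_fin Λ h2
  obtain ⟨E3, hE3⟩ := dd_fin Λ h3
  have t2 := HE_summable hp (fun e he => (hE2 e).2 he)
  have t3 := HE_summable hp (fun e he => (hE3 e).2 he)
  unfold HE
  rw [← t2.tsum_add t3]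
  apply tsum_congr
  intro e
  have e1 : dd (fun x => φ x - χ x) e = dd φ e - dd χ e := by
    simp only [dd]; ring
  rw [e1]
  rcases h e with h | h <;> rw [h] <;> simp [VV_zero (p := p) hp]

lemma peierls {p β κ : ℝ} (hp : 1 < p) (hβ : 4 ≤ β)
    (hK : Real.exp (-β / 8) * KK ≤ (1 / 2) ^ 18)
    (hκ : ∀ (Λ : Finset Site) (χ : Site → ℤ), (∀ x ∉ Λ, χ x = 0) → ∀ h : ℕ, χ (0, 0) = h →
      κ * (h : ℝ) ^ p ≤ HE p χ)
    {Λ : Finset Site} (hΛ : rayLam Λ) (h : ℕ) (hh : 1 ≤ h) :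
    WW p β Λ h ≤ Real.exp (-(β / 2) * (κ * (h : ℝ) ^ p)) * WW p β Λ 0 := by
  have hdec : ∀ φ : Site → ℤ, (∀ x ∉ Λ, φ x = 0) ∧ φ (0, 0) = (h : ℤ) → ∃ χ : Site → ℤ,
      (∀ x ∉ Λ, χ x = 0) ∧ χ (0, 0) = φ (0, 0) ∧ (∀ e, dd χ e = 0 ∨ dd χ e = dd φ e) ∧
      ∃ T, goodT χ T := by
    intro φ hφ
    exact decomp hΛ φ hφ.1 (by rw [hφ.2]; omega)
  choose! c hc1 hc2 hc3 hc4 using hdec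
  have hs0 := GG_summable hp (show 0 < β by linarith) hΛ 0
  apply Real.tsum_le_of_sum_le (fun φ => GG_nonneg _ _ _ _ _)
  intro u
  set u' := u.filter (fun φ : Site → ℤ => (∀ x ∉ Λ, φ x = 0) ∧ φ (0, 0) = (h : ℤ)) with hu'
  have hm : ∀ φ ∈ u', (∀ x ∉ Λ, φ x = 0) ∧ φ (0, 0) = (h : ℤ) := fun φ hφ =>
    (Finset.mem_filter.1 hφ).2
  set D : (Site → ℤ) → (Site → ℤ) × (Site → ℤ) := fun φ => (c φ, fun x => φ x - c φ x) with hD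
  set F : (Site → ℤ) × (Site → ℤ) → ℝ := fun q => Real.exp (-β * HE p q.1) * GG p β Λ 0 q.2 with hF
  have hF0 : ∀ q, 0 ≤ F q := fun q => mul_nonneg (Real.exp_pos _).le (GG_nonneg _ _ _ _ _)
  calc ∑ φ ∈ u, GG p β Λ h φ = ∑ φ ∈ u', Real.exp (-β * HE p φ) := by
        rw [hu', Finset.sum_filter]; rfl
    _ = ∑ φ ∈ u', F (D φ) := by
        apply Finset.sum_congr rfl
        intro φ hφ
        have hv := hm φ hφ
        have e1 : GG p β Λ 0 (fun x => φ x - c φ x) = Real.exp _ :=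
          GG_dec p β Λ 0 (fun x => φ x - c φ x)
            (fun x hx => by simp [hv.1 x hx, hc1 φ hv x hx]) (by simp [hc2 φ hv])
        simp only [hF, hD]
        rw [e1, ← Real.exp_add, HE_split hp φ (c φ) hv.1 (hc1 φ hv) (hc3 φ hv)]
        congr 1; ring
    _ = ∑ q ∈ u'.image D, F q := by
        rw [Finset.sum_image]
        intro a _ b _ hab
        simp only [hD, Prod.mk.injEq] at hab
        funext x
        have h1 := congrFun hab.1 x
        have h2 := congrFun hab.2 x
        omega
    _ ≤ ∑ q ∈ (u'.image c) ×ˢ (u'.image (fun φ x => φ x - c φ x)), F q := by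
        apply Finset.sum_le_sum_of_subset_of_nonneg
        · intro q hq
          obtain ⟨φ, hφ, rfl⟩ := Finset.mem_image.1 hq
          exact Finset.mem_product.2 ⟨Finset.mem_image_of_mem c hφ,
            Finset.mem_image_of_mem (fun φ x => φ x - c φ x) hφ⟩
        · exact fun q _ _ => hF0 q
    _ = (∑ χ ∈ u'.image c, Real.exp (-β * HE p χ)) *
          ∑ ψ ∈ u'.image (fun φ x => φ x - c φ x), GG p β Λ 0 ψ := by
        rw [Finset.sum_mul_sum, Finset.sum_product]
    _ ≤ _ := by
        apply mul_le_mul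
        · apply peierls_sum hp hβ hK hκ (Λ := Λ)
          · intro χ hχ
            obtain ⟨φ, hφ, rfl⟩ := Finset.mem_image.1 hχ
            exact hc1 φ (hm φ hφ)
          · intro χ hχ
            obtain ⟨φ, hφ, rfl⟩ := Finset.mem_image.1 hχ
            rw [hc2 φ (hm φ hφ), (hm φ hφ).2]
          · intro χ hχ
            obtain ⟨φ, hφ, rfl⟩ := Finset.mem_image.1 hχ
            exact hc4 φ (hm φ hφ)
        · exact hs0.sum_le_tsum _ (fun _ _ => GG_nonneg _ _ _ _ _)
        · exact Finset.sum_nonneg (fun _ _ => GG_nonneg _ _ _ _ _)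
        · exact (Real.exp_pos _).le

/-- ratio argument for log-concave sequences -/
lemma ratio_arg (w : ℕ → ℝ) (hw : ∀ n, 0 < w n)
    (hl : ∀ n, w (n + 2) * w n ≤ w (n + 1) * w (n + 1)) (n : ℕ) :
    (w (n + 1) / w n) ^ (n + 1) ≤ w (n + 1) / w 0 := by
  have hanti : Antitone (fun n => w (n + 1) / w n) := by
    apply antitone_nat_of_succ_le
    intro k
    rw [div_le_div_iff₀ (hw _) (hw _)]
    exact hl k
  have hr : 0 < w (n + 1) / w n := div_pos (hw _) (hw _)
  have : ∀ k ≤ n + 1, (w (n + 1) / w n) ^ k ≤ w k / w 0 := by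
    intro k
    induction k with
    | zero => intro _; simp [(hw 0).ne']
    | succ k ih =>
      intro hk
      have h1 := ih (by omega)
      have h2 : w (n + 1) / w n ≤ w (k + 1) / w k := hanti (by omega : k ≤ n)
      rw [pow_succ]
      calc _ ≤ w k / w 0 * (w (k + 1) / w k) :=
            mul_le_mul h1 h2 hr.le (div_pos (hw _) (hw _)).le
        _ = _ := by have := (hw k).ne'; have := (hw 0).ne'; field_simp
  exact this _ le_rfl

/-- **Lemma 4.3.** For `1 < p < 2`:
`π^{(p)}(η_0 = h) ≤ e^{−cβh^{p−1}} π^{(p)}(η_0 = h−1)`. -/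
theorem pSOS_consecutive_ratio (p : ℝ) (hp1 : 1 < p) (hp2 : p < 2) :
    ∃ β₀ > (0 : ℝ), ∀ β ≥ β₀, ∃ c > (0 : ℝ), ∀ h : ℕ, 2 ≤ h →
      ∃ L₀ : ℕ, ∀ L : ℕ, L₀ ≤ L →
        pProb p β (ball L) (fun η => η (0, 0) = (h : ℤ)) ≤
          Real.exp (-c * β * (h : ℝ) ^ (p - 1)) *
            pProb p β (ball L) (fun η => η (0, 0) = (h : ℤ) - 1) := by
  obtain ⟨κ, hκ0, hκ⟩ := energy_bound p hp1 hp2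
  have hKpos : 0 < KK := (summable_exp_int one_pos).tsum_pos (fun _ => (Real.exp_pos _).le) 0
    (Real.exp_pos _)
  refine ⟨max 4 (8 * Real.log (KK * 2 ^ 18)), by positivity, fun β hβ => ⟨κ / 2, by positivity, ?_⟩⟩
  have hβ4 : 4 ≤ β := (le_max_left _ _).trans hβ
  have hβ8 : 8 * Real.log (KK * 2 ^ 18) ≤ β := (le_max_right _ _).trans hβ
  have hK : Real.exp (-β / 8) * KK ≤ (1 / 2) ^ 18 := by
    have h1 : Real.exp (-β / 8) ≤ Real.exp (-Real.log (KK * 2 ^ 18)) := by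
      rw [Real.exp_le_exp]
      generalize Real.log (KK * 2 ^ 18) = l at hβ8
      linarith
    rw [Real.exp_neg, Real.exp_log (by positivity)] at h1
    calc Real.exp (-β / 8) * KK ≤ (KK * 2 ^ 18)⁻¹ * KK := mul_le_mul_of_nonneg_right h1 hKpos.le
      _ = (1 / 2) ^ 18 := by field_simp
  intro h hh
  refine ⟨0, fun L _ => ?_⟩
  have hβ0 : 0 < β := by linarith
  have hΛ := ray_ball L
  have h0 : ((0, 0) : Site) ∈ ball (L : ℝ) := by
    rw [mem_ball_iff]; simp
  obtain ⟨n, rfl⟩ : ∃ n, h = n + 1 := ⟨h - 1, by omega⟩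
  set w : ℕ → ℝ := fun k => WW p β (ball (L : ℝ)) (k : ℤ) with hw
  have hwpos : ∀ k, 0 < w k := fun k => WW_pos hp1 hβ0 hΛ h0 _
  have hra := ratio_arg w hwpos (by
    intro k
    have := logconc hp1 hβ0 hΛ ((k : ℤ) + 1)
    rw [add_sub_cancel_right, show (k : ℤ) + 1 + 1 = ((k + 2 : ℕ) : ℤ) by push_cast; ring,
      show (k : ℤ) + 1 = ((k + 1 : ℕ) : ℤ) by push_cast; ring] at this
    exact this) n
  have hpe : w (n + 1) ≤ Real.exp (-(β / 2) * (κ * ((n + 1 : ℕ) : ℝ) ^ p)) * w 0 :=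
    peierls hp1 hβ4 hK hκ hΛ (n + 1) (by omega)
  have hN : (0 : ℝ) < ((n + 1 : ℕ) : ℝ) := by positivity
  have hpow : ((n + 1 : ℕ) : ℝ) ^ p = ((n + 1 : ℕ) : ℝ) * ((n + 1 : ℕ) : ℝ) ^ (p - 1) := by
    rw [Real.rpow_sub_one hN.ne']; field_simp
  have hr : w (n + 1) / w n ≤ Real.exp (-(κ / 2) * β * ((n + 1 : ℕ) : ℝ) ^ (p - 1)) := by
    have h1 : (w (n + 1) / w n) ^ (n + 1) ≤
        (Real.exp (-(κ / 2) * β * ((n + 1 : ℕ) : ℝ) ^ (p - 1))) ^ (n + 1) := by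
      refine hra.trans ?_
      rw [div_le_iff₀ (hwpos 0), ← Real.exp_nat_mul]
      refine hpe.trans (le_of_eq ?_)
      rw [hpow]
      congr 2; ring
    exact le_of_pow_le_pow_left₀ (by omega) (Real.exp_pos _).le h1
  rw [div_le_iff₀ (hwpos n)] at hr
  unfold pProb
  rw [pW_eq hp1, pW_eq hp1, ← mul_div_assoc]
  apply div_le_div_of_nonneg_right
  · rw [show ((n + 1 : ℕ) : ℤ) - 1 = (n : ℤ) by push_cast; ring]
    exact hr
  · unfold pW
    apply tsum_nonneg
    intro η
    split_ifs
    · exact (Real.exp_pos _).le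
    · exact le_rfl
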